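/- Let D be a (ℤ×G)-graded division algebra over a field F of characteristic different from 2 (G a finitely generated abelian group), and let γ₀ = (g₁,…,g_{k₀}) ∈ G^{k₀}, γ₁ = (g_{k₀+1},…,g_{k₀+k₁}) ∈ G^{k₁}. Then the opposite graded algebra M(G,D,γ₀,γ₁)^op is isomorphic as a (ℤ×G)-graded algebra to M(G,D^op,γ₀^{−1},γ₁^{−1}), where γ^{−1} denotes the tuple of inverses. -/

import Mathlib

universe u v w

/-!
STATEMENT 10.  Let D be a (ℤ×G)-graded division algebra over F (char F ≠ 2, G finitely
generated abelian) and γ₀ ∈ G^{k₀}, γ₁ ∈ G^{k₁}.  Then M(G,D,γ₀,γ₁)^op ≅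
M(G,D^op,γ₀⁻¹,γ₁⁻¹) as (ℤ×G)-graded algebras.

The matrix index set Fin(k₀+k₁) is realized as `Fin k₀ ⊕ Fin k₁`, with δ = 0 on the first
block and δ = 1 on the second, and the grading of M_n(D) is
deg(dE₍ᵢⱼ₎) = (δᵢ−δⱼ+deg₁(d), gᵢ·deg₂(d)·gⱼ⁻¹): homogeneous component at p = (m,h) consists
of the matrices X with X i j ∈ D₍m−δᵢ+δⱼ, γᵢ⁻¹·h·γⱼ₎ for all i,j.
-/

/-- The opposite grading on `A^op`: `(A^op)₍ᵢ,g₎ = A₍₋ᵢ,g₎`. -/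
def opGr {F : Type u} [Field F] {G : Type v} [CommGroup G] {A : Type w} [Ring A] [Algebra F A]
    (Γ : ℤ × G → Submodule F A) : ℤ × G → Submodule F Aᵐᵒᵖ :=
  fun p => (Γ (-p.1, p.2)).map (MulOpposite.opLinearEquiv F).toLinearMap

/-- The grading of the matrix algebra `M(G,D,γ)` determined by the tuple `γ` and the parity
vector `δ`. -/
def matGr {F : Type u} [Field F] {G : Type v} [CommGroup G] {D : Type w} [Ring D] [Algebra F D]
    (Dgr : ℤ × G → Submodule F D) {ι : Type*} (γ : ι → G) (δ : ι → ℤ) (p : ℤ × G) :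
    Submodule F (Matrix ι ι D) where
  carrier := {X | ∀ i j, X i j ∈ Dgr (p.1 - δ i + δ j, (γ i)⁻¹ * p.2 * γ j)}
  add_mem' := by
    intro X Y hX hY i j
    simpa [Matrix.add_apply] using add_mem (hX i j) (hY i j)
  zero_mem' := by
    intro i j
    simp only [Matrix.zero_apply]
    exact Submodule.zero_mem _
  smul_mem' := by
    intro c X hX i j
    simpa [Matrix.smul_apply] using Submodule.smul_mem _ c (hX i j)

theorem mem_opGr {F : Type u} [Field F] {G : Type v} [CommGroup G] {A : Type w} [Ring A]
    [Algebra F A] (Γ : ℤ × G → Submodule F A) (p : ℤ × G) (x : Aᵐᵒᵖ) :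
    x ∈ opGr Γ p ↔ x.unop ∈ Γ (-p.1, p.2) :=
  ⟨by rintro ⟨y, hy, rfl⟩; exact hy, fun h => ⟨x.unop, h, rfl⟩⟩

/-- Entrywise `op` composed with the transpose carries the opposite of the matrix grading for `γ`
to the matrix grading for `γ⁻¹` over the opposite algebra. -/
theorem map_mopMatrix_symm_opGr_matGr {F : Type u} [Field F] {G : Type v} [CommGroup G]
    {D : Type w} [Ring D] [Algebra F D] (Dgr : ℤ × G → Submodule F D)
    {ι : Type*} [Fintype ι] [DecidableEq ι] (γ : ι → G) (δ : ι → ℤ) (p : ℤ × G) :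
    (opGr (matGr Dgr γ δ) p).map
        (AlgEquiv.mopMatrix.symm : (Matrix ι ι D)ᵐᵒᵖ ≃ₐ[F] Matrix ι ι Dᵐᵒᵖ).toLinearMap
      = matGr (opGr Dgr) (fun i => (γ i)⁻¹) δ p := by
  have hdeg (i j : ι) : (-p.1 - δ j + δ i, (γ j)⁻¹ * p.2 * γ i)
      = (-(p.1 - δ i + δ j), (γ i)⁻¹⁻¹ * p.2 * (γ j)⁻¹) := by
    ext
    · dsimp only; ring
    · dsimp only; rw [inv_inv, mul_comm _ (γ i), mul_comm (γ j)⁻¹, mul_assoc]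
  ext Y
  constructor
  · rintro ⟨X, hX, rfl⟩ i j
    rw [SetLike.mem_coe, mem_opGr] at hX
    rw [mem_opGr, ← hdeg]
    exact hX j i
  · intro hY
    refine ⟨AlgEquiv.mopMatrix (R := F) Y, ?_, AlgEquiv.symm_apply_apply _ Y⟩
    rw [SetLike.mem_coe, mem_opGr]
    intro i j
    have h := (mem_opGr _ _ _).1 (hY j i)
    rw [← hdeg] at h
    exact h

theorem stmt_10
    (F : Type u) [Field F] (hchar : ringChar F ≠ 2)
    (G : Type v) [CommGroup G] [DecidableEq G] (hG : Group.FG G)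
    -- the (ℤ×G)-graded division algebra D
    (D : Type w) [Ring D] [Algebra F D] [FiniteDimensional F D]
    (Dgr : ℤ × G → Submodule F D)
    (hinternal : DirectSum.IsInternal Dgr)
    (hone : (1 : D) ∈ Dgr (0, 1))
    (hmul : ∀ p q : ℤ × G, ∀ x ∈ Dgr p, ∀ y ∈ Dgr q, x * y ∈ Dgr (p.1 + q.1, p.2 * q.2))
    (hdiv : ∀ p : ℤ × G, ∀ x ∈ Dgr p, x ≠ 0 → IsUnit x)
    -- the tuples
    (k₀ k₁ : ℕ) (γ₀ : Fin k₀ → G) (γ₁ : Fin k₁ → G) :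
    -- M(G,D,γ₀,γ₁)^op ≅ M(G,D^op,γ₀⁻¹,γ₁⁻¹) as (ℤ×G)-graded algebras
    ∃ e : (Matrix (Fin k₀ ⊕ Fin k₁) (Fin k₀ ⊕ Fin k₁) D)ᵐᵒᵖ ≃ₐ[F]
        Matrix (Fin k₀ ⊕ Fin k₁) (Fin k₀ ⊕ Fin k₁) Dᵐᵒᵖ,
      ∀ p : ℤ × G,
        Submodule.map
          (e : (Matrix (Fin k₀ ⊕ Fin k₁) (Fin k₀ ⊕ Fin k₁) D)ᵐᵒᵖ →ₗ[F]
            Matrix (Fin k₀ ⊕ Fin k₁) (Fin k₀ ⊕ Fin k₁) Dᵐᵒᵖ)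
          (opGr (matGr Dgr (Sum.elim γ₀ γ₁) (Sum.elim (fun _ => (0 : ℤ)) fun _ => 1)) p)
        = matGr (opGr Dgr) (Sum.elim (fun i => (γ₀ i)⁻¹) fun i => (γ₁ i)⁻¹)
            (Sum.elim (fun _ => (0 : ℤ)) fun _ => 1) p := by
  refine ⟨AlgEquiv.mopMatrix.symm, fun p => ?_⟩
  have hinv : (Sum.elim (fun i => (γ₀ i)⁻¹) fun i => (γ₁ i)⁻¹)
      = fun i => (Sum.elim γ₀ γ₁ i)⁻¹ := by
    ext (i | i) <;> rfl
  rw [hinv]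
  exact map_mopMatrix_symm_opGr_matGr Dgr _ _ p
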